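/- Let T > 0 and λ > 0, and let β be a real number. Define c : [0,T] → ℝ by c(t) = ( 1/β + (1/λ − 1/β) e^{−β(T−t)} )^{−1} if β ≠ 0, and c(t) = (T − t + 1/λ)^{−1} if β = 0. Then c is well defined and strictly positive on [0,T], and: (i) if β < λ then c is strictly increasing on [0,T]; (ii) if β > λ then c is strictly decreasing on [0,T]; (iii) if β = λ then c is constant, equal to λ. -/

import Mathlib

open Set

/-- The reciprocal of the consumption policy is positive at any nonnegative time to maturity. -/
theorem consumption_denom_pos {lam β s : ℝ} (hlam : 0 < lam) (hβ : β ≠ 0) (hs : 0 ≤ s) :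
    0 < 1 / β + (1 / lam - 1 / β) * Real.exp (-β * s) := by
  have h : 0 ≤ (1 - Real.exp (-β * s)) / β := by
    rcases lt_or_gt_of_ne hβ with h | h
    · exact div_nonneg_of_nonpos (by
        have := Real.one_le_exp (x := -β * s) (by nlinarith)
        linarith) h.le
    · exact div_nonneg (by
        have := Real.exp_le_one_iff (x := -β * s) |>.2 (by nlinarith)
        linarith) h.le
  have h' : 0 < Real.exp (-β * s) / lam := by positivity
  calc 0 < (1 - Real.exp (-β * s)) / β + Real.exp (-β * s) / lam := by linarith
    _ = _ := by ring

/-- three-regime monotonicity of the equilibrium consumption policy: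
`c` is well defined and positive on `[0,T]`; it is strictly increasing if `β < λ`,
strictly decreasing if `β > λ`, and constant equal to `λ` if `β = λ`. -/
theorem stmt_18 (T lam β : ℝ) (hT : 0 < T) (hlam : 0 < lam)
    (c : ℝ → ℝ)
    (hc : ∀ t, c t = if β = 0 then (T - t + 1 / lam)⁻¹
        else (1 / β + (1 / lam - 1 / β) * Real.exp (-β * (T - t)))⁻¹) :
    (∀ t ∈ Icc 0 T,
      (β ≠ 0 → 0 < 1 / β + (1 / lam - 1 / β) * Real.exp (-β * (T - t))) ∧
      0 < T - t + 1 / lam ∧ 0 < c t) ∧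
    (β < lam → StrictMonoOn c (Icc 0 T)) ∧
    (lam < β → StrictAntiOn c (Icc 0 T)) ∧
    (β = lam → ∀ t ∈ Icc 0 T, c t = lam) := by
  have hpos : 0 < 1 / lam := by positivity
  have hden : ∀ t ∈ Icc 0 T, β ≠ 0 →
      0 < 1 / β + (1 / lam - 1 / β) * Real.exp (-β * (T - t)) :=
    fun t ht hβ => consumption_denom_pos hlam hβ (sub_nonneg.2 ht.2)
  refine ⟨fun t ht => ?_, fun h x hx y hy hxy => ?_, fun h x hx y hy hxy => ?_, fun h t ht => ?_⟩
  · have h0 : 0 < T - t + 1 / lam := by linarith [ht.2]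
    refine ⟨hden t ht, h0, ?_⟩
    rw [hc]
    split_ifs with hβ
    · exact inv_pos.2 h0
    · exact inv_pos.2 (hden t ht hβ)
  · rw [hc, hc]
    split_ifs with hβ
    · exact inv_strictAnti₀ (by linarith [hy.2]) (by linarith)
    · refine inv_strictAnti₀ (hden y hy hβ) ?_
      rcases lt_or_gt_of_ne hβ with hneg | hβpos
      · have hexp : Real.exp (-β * (T - y)) < Real.exp (-β * (T - x)) :=
          Real.exp_lt_exp.2 (by nlinarith)
        have hcoef : 0 < 1 / lam - 1 / β := by
          linarith [one_div_neg.2 hneg]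
        linarith [mul_lt_mul_of_pos_left hexp hcoef]
      · have hexp : Real.exp (-β * (T - x)) < Real.exp (-β * (T - y)) :=
          Real.exp_lt_exp.2 (by nlinarith)
        have hcoef : 1 / lam - 1 / β < 0 := sub_neg.2 (one_div_lt_one_div_of_lt hβpos h)
        linarith [mul_lt_mul_of_neg_left hexp hcoef]
  · have hβpos : 0 < β := hlam.trans h
    rw [hc, hc, if_neg hβpos.ne', if_neg hβpos.ne']
    refine inv_strictAnti₀ (hden x hx hβpos.ne') ?_
    have hexp : Real.exp (-β * (T - x)) < Real.exp (-β * (T - y)) :=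
      Real.exp_lt_exp.2 (by nlinarith)
    have hcoef : 0 < 1 / lam - 1 / β := sub_pos.2 (one_div_lt_one_div_of_lt hlam h)
    linarith [mul_lt_mul_of_pos_left hexp hcoef]
  · subst h
    rw [hc, if_neg hlam.ne']
    simp
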